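/- arXiv:math-ph/0507049 — 2 statements merged into one kernel-verified Lean document; each statement's English description precedes it below -/
import Mathlib

section
/- Scattering length energy identity: Let v be a potential with scattering length a_v and zero-energy scattering solution φ as in the context. Then ∫_{ℝ³} |∇φ(x)|² dx + (1/2) ∫_{ℝ³} v(x) |φ(x)|² dx = 4π a_v. -/
/-!
STATEMENT 4: Scattering length energy identity.
If `v : ℝ³ → [0,∞)` is bounded, measurable, radial, supported in `{|x| ≤ R₀}`,
and `φ` is its zero-energy scattering solution (C¹, `0 ≤ φ ≤ 1`,
`-Δφ + (1/2) v φ = 0` distributionally, `φ(x) = 1 - a/|x|` for `|x| ≥ R₀`), then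
`∫ |∇φ|² + (1/2) ∫ v |φ|² = 4 π a`.
-/

open MeasureTheory Real
open scoped RealInnerProductSpace

noncomputable section

abbrev R3 := EuclideanSpace ℝ (Fin 3)

/-- A `C¹` function vanishing outside a ball is a uniform limit, together with its derivative,
of smooth functions vanishing outside a slightly larger ball. -/
theorem ContDiff.exists_smooth_norm_sub_le_norm_fderiv_sub_le {E : Type*} [NormedAddCommGroup E]
    [InnerProductSpace ℝ E] [FiniteDimensional ℝ E] {g : E → ℝ} (hg : ContDiff ℝ 1 g) {R : ℝ}
    (hR : ∀ x, R ≤ ‖x‖ → g x = 0) {ε : ℝ} (hε : 0 < ε) :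
    ∃ h : E → ℝ, ContDiff ℝ (⊤ : ℕ∞) h ∧ (∀ x, R + 1 ≤ ‖x‖ → h x = 0) ∧
      ∀ x, ‖h x - g x‖ ≤ ε ∧ ‖fderiv ℝ h x - fderiv ℝ g x‖ ≤ ε := by
  borelize E
  let μ : Measure E := Measure.addHaar
  have hgc : HasCompactSupport g := HasCompactSupport.intro (isCompact_closedBall 0 R) fun x hx ↦
    hR x (by simp at hx; exact hx.le)
  have hdg : Continuous (fderiv ℝ g) := hg.continuous_fderiv (by simp)
  obtain ⟨δ₁, hδ₁, h₁⟩ := Metric.uniformContinuous_iff.1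
    (hgc.uniformContinuous_of_continuous hg.continuous) ε hε
  obtain ⟨δ₂, hδ₂, h₂⟩ := Metric.uniformContinuous_iff.1
    ((hgc.fderiv ℝ).uniformContinuous_of_continuous hdg) ε hε
  obtain ⟨δ, hδ, hδlt⟩ : ∃ δ, 0 < δ ∧ δ ≤ δ₁ ∧ δ ≤ δ₂ ∧ δ ≤ 1 :=
    ⟨min δ₁ (min δ₂ 1), by positivity, by simp, by simp, by simp⟩
  let ρ : ContDiffBump (0 : E) := ⟨δ / 2, δ, by positivity, by linarith⟩
  have hgl : LocallyIntegrable g μ := hg.continuous.locallyIntegrable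
  have hρl : LocallyIntegrable (ρ.normed μ) μ := ρ.continuous_normed.locallyIntegrable
  refine ⟨convolution (ρ.normed μ) g (ContinuousLinearMap.lsmul ℝ ℝ) μ, ?_, fun x hx ↦ ?_,
    fun x ↦ ⟨?_, ?_⟩⟩
  · exact ρ.hasCompactSupport_normed.contDiff_convolution_left _ ρ.contDiff_normed hgl
  · rw [ρ.normed_convolution_eq_right, hR x (by linarith)]
    intro y hy
    have hy : ‖y - x‖ < δ := mem_ball_iff_norm.1 hy
    have := norm_sub_norm_le x y
    rw [hR x (by linarith), hR y]
    rw [norm_sub_rev] at hy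
    linarith
  · rw [← dist_eq_norm]
    refine ρ.dist_normed_convolution_le hg.continuous.aestronglyMeasurable fun y hy ↦ ?_
    exact (h₁ (lt_of_lt_of_le hy hδlt.1)).le
  · rw [← dist_eq_norm,
      (hgc.hasFDerivAt_convolution_right (ContinuousLinearMap.lsmul ℝ ℝ) hρl hg x).fderiv]
    refine ρ.dist_normed_convolution_le (μ := μ) hdg.aestronglyMeasurable fun y hy ↦ ?_
    exact (h₂ (lt_of_lt_of_le hy hδlt.2.1)).le

/-- A weak equation tested against smooth compactly supported functions may be tested against
`C¹` functions vanishing outside a ball. -/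
theorem weak_equation_of_contDiff_one {E : Type*} [NormedAddCommGroup E]
    [InnerProductSpace ℝ E] [FiniteDimensional ℝ E] [MeasurableSpace E] [BorelSpace E]
    {μ : Measure E} [IsFiniteMeasureOnCompacts μ] {F : E → E} {u : E → ℝ} {c : ℝ}
    (hF : LocallyIntegrable F μ) (hu : LocallyIntegrable u μ)
    (h : ∀ g : E → ℝ, ContDiff ℝ (⊤ : ℕ∞) g → HasCompactSupport g →
      (∫ x, ⟪F x, gradient g x⟫ ∂μ) + c * ∫ x, u x * g x ∂μ = 0)
    {g : E → ℝ} (hg : ContDiff ℝ 1 g) {R : ℝ} (hR : ∀ x, R ≤ ‖x‖ → g x = 0) :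
    (∫ x, ⟪F x, gradient g x⟫ ∂μ) + c * ∫ x, u x * g x ∂μ = 0 := by
  have grad_cont {f : E → ℝ} (hf : ContDiff ℝ 1 f) : Continuous (gradient f) :=
    (LinearIsometryEquiv.continuous _).comp (hf.continuous_fderiv (by simp))
  have hgc {R : ℝ} {g : E → ℝ} (hR : ∀ x, R ≤ ‖x‖ → g x = 0) : HasCompactSupport g :=
    HasCompactSupport.intro (isCompact_closedBall 0 R) fun x hx ↦
      hR x (by simp at hx; exact hx.le)
  choose! G hGs hGR hGd using fun ε hε ↦
    hg.exists_smooth_norm_sub_le_norm_fderiv_sub_le hR (ε := ε) hε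
  let ε : ℕ → ℝ := fun n ↦ 1 / ((n : ℝ) + 1)
  have hεpos n : 0 < ε n := by positivity
  have hε1 n : ε n ≤ 1 := by
    simp only [ε]; rw [div_le_one (by positivity)]; linarith [n.cast_nonneg (α := ℝ)]
  have hε0 : Filter.Tendsto ε Filter.atTop (nhds 0) := tendsto_one_div_add_atTop_nhds_zero_nat
  have hgrad n x : ‖gradient (G (ε n)) x - gradient g x‖ ≤ ε n := by
    simpa [gradient, ← map_sub] using (hGd _ (hεpos n) x).2
  obtain ⟨M₁, hM₁⟩ := hg.continuous.bounded_above_of_compact_support (hgc hR)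
  obtain ⟨M₂, hM₂⟩ := (hg.continuous_fderiv (by simp)).bounded_above_of_compact_support
    ((hgc hR).fderiv ℝ)
  have hM₂' x : ‖gradient g x‖ ≤ M₂ := by simpa [gradient] using hM₂ x
  let K : Set E := Metric.closedBall 0 (R + 1)
  have hK : IsCompact K := isCompact_closedBall 0 (R + 1)
  have hKm : MeasurableSet K := hK.measurableSet
  have gradzero n x (hx : x ∉ K) : gradient (G (ε n)) x = 0 := by
    have : G (ε n) =ᶠ[nhds x] fun _ ↦ 0 := by
      filter_upwards [hK.isClosed.isOpen_compl.mem_nhds hx] with y hy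
      refine hGR _ (hεpos n) y ?_
      simp [K] at hy
      exact hy.le
    rw [this.gradient_eq, gradient_fun_const]
  have gzero n x (hx : x ∉ K) : G (ε n) x = 0 := by
    refine hGR _ (hεpos n) x ?_
    simp [K] at hx
    exact hx.le
  have lim₁ : Filter.Tendsto (fun n ↦ ∫ x, ⟪F x, gradient (G (ε n)) x⟫ ∂μ) Filter.atTop
      (nhds (∫ x, ⟪F x, gradient g x⟫ ∂μ)) := by
    refine tendsto_integral_of_dominated_convergence
      (K.indicator fun x ↦ ‖F x‖ * (M₂ + 1)) (fun n ↦ ?_) ?_ (fun n ↦ .of_forall fun x ↦ ?_)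
      (.of_forall fun x ↦ ?_)
    · exact hF.aestronglyMeasurable.inner
        (grad_cont ((hGs _ (hεpos n)).of_le (by simp))).aestronglyMeasurable
    · exact (integrable_indicator_iff hKm).2 ((hF.integrableOn_isCompact hK).norm.mul_const _)
    · by_cases hx : x ∈ K
      · rw [Set.indicator_of_mem hx]
        refine (norm_inner_le_norm _ _).trans ?_
        gcongr
        have h1 := hgrad n x
        linarith [norm_le_norm_add_norm_sub (gradient g x) (gradient (G (ε n)) x), hM₂' x, hε1 n,
          norm_sub_rev (gradient g x) (gradient (G (ε n)) x)]
      · simp [gradzero n x hx, hx]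
    · refine tendsto_const_nhds.inner ?_
      exact tendsto_iff_norm_sub_tendsto_zero.2 (squeeze_zero (fun _ ↦ norm_nonneg _)
        (fun n ↦ hgrad n x) hε0)
  have lim₂ : Filter.Tendsto (fun n ↦ ∫ x, u x * G (ε n) x ∂μ) Filter.atTop
      (nhds (∫ x, u x * g x ∂μ)) := by
    refine tendsto_integral_of_dominated_convergence
      (K.indicator fun x ↦ ‖u x‖ * (M₁ + 1)) (fun n ↦ ?_) ?_ (fun n ↦ .of_forall fun x ↦ ?_)
      (.of_forall fun x ↦ ?_)
    · exact hu.aestronglyMeasurable.mul (hGs _ (hεpos n)).continuous.aestronglyMeasurable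
    · exact (integrable_indicator_iff hKm).2 ((hu.integrableOn_isCompact hK).norm.mul_const _)
    · by_cases hx : x ∈ K
      · rw [Set.indicator_of_mem hx, norm_mul]
        gcongr
        have h1 := (hGd _ (hεpos n) x).1
        linarith [norm_le_norm_add_norm_sub (g x) (G (ε n) x), hM₁ x, hε1 n,
          norm_sub_rev (g x) (G (ε n) x)]
      · simp [gzero n x hx, hx]
    · refine tendsto_const_nhds.mul ?_
      exact tendsto_iff_norm_sub_tendsto_zero.2 (squeeze_zero (fun _ ↦ norm_nonneg _)
        (fun n ↦ (hGd _ (hεpos n) x).1) hε0)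
  refine tendsto_nhds_unique (lim₁.add (lim₂.const_mul c)) ?_
  simp only [fun n ↦ h (G (ε n)) (hGs _ (hεpos n)) (hgc (hGR _ (hεpos n)))]
  exact tendsto_const_nhds

/-- The gradient of a radial function away from the origin. -/
theorem hasGradientAt_comp_norm {E : Type*} [NormedAddCommGroup E] [InnerProductSpace ℝ E]
    [CompleteSpace E] {p : ℝ → ℝ} {p' : ℝ} {x : E} (hx : x ≠ 0) (hp : HasDerivAt p p' ‖x‖) :
    HasGradientAt (fun y ↦ p ‖y‖) ((p' / ‖x‖) • x) x := by
  have hx' : ‖x‖ ≠ 0 := norm_ne_zero_iff.2 hx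
  have hn : HasFDerivAt (fun y : E ↦ ‖y‖) (‖x‖⁻¹ • innerSL ℝ x) x := by
    have := (hasStrictFDerivAt_norm_sq x).hasFDerivAt.sqrt (pow_ne_zero 2 hx')
    simp only [Real.sqrt_sq (norm_nonneg _)] at this
    convert this using 1
    ext y
    simp
    field_simp
  rw [hasGradientAt_iff_hasFDerivAt]
  refine HasFDerivAt.congr_fderiv (hp.comp_hasFDerivAt x hn) ?_
  ext y
  simp [div_eq_mul_inv, mul_assoc]

theorem gradient_of_eq_one_sub_div_norm {φ : R3 → ℝ} {R a : ℝ} (hR : 0 < R)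
    (hφ : ∀ x : R3, R ≤ ‖x‖ → φ x = 1 - a / ‖x‖) {x : R3} (hx : R < ‖x‖) :
    gradient φ x = (a / ‖x‖ ^ 3) • x := by
  have hx0 : ‖x‖ ≠ 0 := (hR.trans hx).ne'
  have hev : φ =ᶠ[nhds x] fun y ↦ 1 - a / ‖y‖ := by
    filter_upwards [continuous_norm.continuousAt.eventually (lt_mem_nhds hx)] with y hy
    exact hφ y hy.le
  have hd : HasDerivAt (fun r : ℝ ↦ 1 - a / r) (a / ‖x‖ ^ 2) ‖x‖ := by
    simpa [div_eq_mul_inv] using ((hasDerivAt_inv hx0).const_mul a).const_sub 1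
  rw [hev.gradient_eq, (hasGradientAt_comp_norm (norm_ne_zero_iff.1 hx0) hd).gradient]
  congr 1
  field_simp

theorem integrable_norm_gradient_sq_of_eq_one_sub_div_norm {φ : R3 → ℝ} {R a : ℝ} (hR : 0 < R)
    (hc : ContDiff ℝ 1 φ) (hφ : ∀ x : R3, R ≤ ‖x‖ → φ x = 1 - a / ‖x‖) :
    Integrable fun x ↦ ‖gradient φ x‖ ^ 2 := by
  have hcont : Continuous (gradient φ) :=
    (LinearIsometryEquiv.continuous _).comp (hc.continuous_fderiv (by simp))
  have hint : Integrable (fun x : R3 ↦ (1 + ‖x‖) ^ (-4 : ℝ)) :=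
    integrable_one_add_norm (by simp; norm_num)
  refine (hcont.norm.pow 2).locallyIntegrable.integrable_of_isBigO_cocompact ?_
    (hint.integrableAtFilter _)
  refine Asymptotics.IsBigO.of_bound (16 * a ^ 2) ?_
  filter_upwards [tendsto_norm_cocompact_atTop.eventually_gt_atTop (max R 1)] with x hx
  have h1 : R < ‖x‖ := (le_max_left _ _).trans_lt hx
  have h2 : 1 < ‖x‖ := (le_max_right _ _).trans_lt hx
  rw [Pi.pow_apply, gradient_of_eq_one_sub_div_norm hR hφ h1, norm_smul,
    show (-4 : ℝ) = -((4 : ℕ) : ℝ) by norm_num, Real.rpow_neg (by positivity), Real.rpow_natCast]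
  have h3 : (1 + ‖x‖) ^ 4 ≤ 16 * ‖x‖ ^ 4 := by
    calc (1 + ‖x‖) ^ 4 ≤ (2 * ‖x‖) ^ 4 := by gcongr; linarith
      _ = 16 * ‖x‖ ^ 4 := by ring
  rw [Real.norm_of_nonneg (show 0 ≤ (‖a / ‖x‖ ^ 3‖ * ‖x‖) ^ 2 by positivity),
    Real.norm_of_nonneg (show 0 ≤ ((1 + ‖x‖) ^ 4)⁻¹ by positivity), mul_pow, Real.norm_eq_abs,
    sq_abs, ← div_eq_mul_inv, le_div_iff₀ (by positivity)]
  calc (a / ‖x‖ ^ 3) ^ 2 * ‖x‖ ^ 2 * (1 + ‖x‖) ^ 4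
      ≤ (a / ‖x‖ ^ 3) ^ 2 * ‖x‖ ^ 2 * (16 * ‖x‖ ^ 4) := by gcongr
    _ = 16 * a ^ 2 := by field_simp

/-- Integration of a radial function on `ℝ³` in polar coordinates. -/
theorem integral_comp_norm (f : ℝ → ℝ) :
    ∫ x : R3, f ‖x‖ = 4 * π * ∫ r in Set.Ioi (0 : ℝ), r ^ 2 * f r := by
  have h : (volume : Measure R3).real (Metric.ball 0 1) = π * 4 / 3 := by
    rw [Measure.real, EuclideanSpace.volume_ball_fin_three]
    simp [ENNReal.toReal_ofReal (show 0 ≤ π * 4 / 3 by positivity)]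
  rw [integral_fun_norm_addHaar, h]
  simp
  ring

/-- The smooth profile equal to `1` on `[0, L]` and to `0` on `[2 * L, ∞)`. -/
def radialCutoff (L r : ℝ) : ℝ := smoothTransition (2 - (r / L) ^ 2)

/-- The derivative of `radialCutoff L` at `r` is `-(r / L ^ 2) * cutoffSlope (r / L)`. -/
def cutoffSlope (t : ℝ) : ℝ := 2 * deriv smoothTransition (2 - t ^ 2)

theorem hasDerivAt_radialCutoff (L r : ℝ) :
    HasDerivAt (radialCutoff L) (-(r / L ^ 2) * cutoffSlope (r / L)) r := by
  have h : HasDerivAt smoothTransition (deriv smoothTransition (2 - (r / L) ^ 2))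
      (2 - (r / L) ^ 2) :=
    ((smoothTransition.contDiff (n := 1)).differentiable (by simp) _).hasDerivAt
  have h2 : HasDerivAt (fun r : ℝ ↦ 2 - (r / L) ^ 2) (-(2 * (r / L) * (1 / L))) r := by
    simpa using (((hasDerivAt_id r).div_const L).pow 2).const_sub 2
  refine HasDerivAt.congr_deriv (f := radialCutoff L) (h.comp r h2) ?_
  rw [cutoffSlope]
  ring

theorem radialCutoff_eq_one {L r : ℝ} (hr : 0 ≤ r) (h : r ≤ L) : radialCutoff L r = 1 := by
  refine smoothTransition.one_of_one_le ?_
  have : (r / L) ^ 2 ≤ 1 :=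
    pow_le_one₀ (div_nonneg hr (hr.trans h)) (div_le_one_of_le₀ h (hr.trans h))
  linarith

theorem radialCutoff_eq_zero {L r : ℝ} (hL : 0 < L) (h : 2 * L ≤ r) : radialCutoff L r = 0 := by
  refine smoothTransition.zero_of_nonpos ?_
  have : 2 ≤ r / L := (le_div_iff₀ hL).2 h
  nlinarith

theorem continuous_cutoffSlope : Continuous cutoffSlope := by
  have : Continuous (deriv smoothTransition) :=
    (smoothTransition.contDiff (n := 1)).continuous_deriv (by simp)
  unfold cutoffSlope
  fun_prop

theorem cutoffSlope_eq_zero_of_two_le {t : ℝ} (ht : 2 ≤ |t|) : cutoffSlope t = 0 := by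
  have h : smoothTransition =ᶠ[nhds (2 - t ^ 2)] fun _ ↦ 0 := by
    filter_upwards [gt_mem_nhds (show 2 - t ^ 2 < 0 by nlinarith [sq_abs t])] with y hy
    exact smoothTransition.zero_of_nonpos hy.le
  simp [cutoffSlope, h.deriv_eq]

theorem cutoffSlope_eq_zero_of_lt_one {t : ℝ} (ht : |t| < 1) : cutoffSlope t = 0 := by
  have h : smoothTransition =ᶠ[nhds (2 - t ^ 2)] fun _ ↦ 1 := by
    filter_upwards [lt_mem_nhds (show 1 < 2 - t ^ 2 by nlinarith [sq_abs t, abs_nonneg t])]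
      with y hy
    exact smoothTransition.one_of_one_le hy.le
  simp [cutoffSlope, h.deriv_eq]

theorem hasCompactSupport_cutoffSlope : HasCompactSupport cutoffSlope :=
  HasCompactSupport.intro (isCompact_closedBall 0 2) fun t ht ↦
    cutoffSlope_eq_zero_of_two_le (by simp at ht; exact ht.le)

theorem integral_radialCutoff_flux (a : ℝ) {L : ℝ} (hL : 0 < L) :
    ∫ r in Set.Ioi (0 : ℝ),
        r ^ 2 * ((1 - a / r) * ((a / r ^ 2) * (-(r / L ^ 2) * cutoffSlope (r / L)))) =
      -a + a ^ 2 * (∫ t in Set.Ioi (0 : ℝ), cutoffSlope t) * L⁻¹ := by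
  have hk : HasCompactSupport fun r ↦ cutoffSlope (r / L) := by
    refine HasCompactSupport.intro (isCompact_closedBall 0 (2 * L)) fun r hr ↦
      cutoffSlope_eq_zero_of_two_le ?_
    simp at hr
    rw [abs_div, abs_of_pos hL, le_div_iff₀ hL]
    exact hr.le
  have hkc : Continuous fun r ↦ cutoffSlope (r / L) :=
    continuous_cutoffSlope.comp (continuous_id.div_const L)
  have hs : Integrable fun r ↦ -(r / L ^ 2) * cutoffSlope (r / L) :=
    Continuous.integrable_of_hasCompactSupport (by fun_prop) hk.mul_left
  have hderiv : ∫ r in Set.Ioi (0 : ℝ), -(r / L ^ 2) * cutoffSlope (r / L) = -1 := by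
    rw [integral_Ioi_of_hasDerivAt_of_tendsto (f := radialCutoff L) (m := 0)
      (hasDerivAt_radialCutoff L 0).continuousAt.continuousWithinAt
      (fun r _ ↦ hasDerivAt_radialCutoff L r) hs.integrableOn, radialCutoff_eq_one le_rfl hL.le]
    · norm_num
    · refine tendsto_const_nhds.congr' ?_
      filter_upwards [Filter.eventually_ge_atTop (2 * L)] with r hr
      exact (radialCutoff_eq_zero hL hr).symm
  have hscale : ∫ r in Set.Ioi (0 : ℝ), cutoffSlope (r / L) =
      L * ∫ t in Set.Ioi (0 : ℝ), cutoffSlope t := by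
    simpa [div_eq_inv_mul] using integral_comp_mul_left_Ioi cutoffSlope 0 (inv_pos.2 hL)
  calc _ = ∫ r in Set.Ioi (0 : ℝ), (a * (-(r / L ^ 2) * cutoffSlope (r / L)) +
        a ^ 2 / L ^ 2 * cutoffSlope (r / L)) := by
        refine setIntegral_congr_fun measurableSet_Ioi fun r hr ↦ ?_
        have hr : r ≠ 0 := (Set.mem_Ioi.1 hr).ne'
        field_simp
        ring
    _ = _ := by
        rw [integral_add (hs.const_mul a).integrableOn
          ((hkc.integrable_of_hasCompactSupport hk).const_mul _).integrableOn,
          integral_const_mul, integral_const_mul, hderiv, hscale]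
        field_simp

theorem contDiff_radialCutoff_norm (L : ℝ) {n : ℕ∞} :
    ContDiff ℝ n fun x : R3 ↦ radialCutoff L ‖x‖ := by
  have : ContDiff ℝ n fun x : R3 ↦ 2 - ‖x‖ ^ 2 / L ^ 2 :=
    contDiff_const.sub ((contDiff_norm_sq ℝ).div_const _)
  simpa [radialCutoff, div_pow] using! smoothTransition.contDiff.comp this

theorem gradient_radialCutoff_norm {L : ℝ} (hL : 0 < L) (x : R3) :
    gradient (fun y : R3 ↦ radialCutoff L ‖y‖) x =
      ((-(‖x‖ / L ^ 2) * cutoffSlope (‖x‖ / L)) / ‖x‖) • x := by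
  rcases eq_or_ne x 0 with rfl | hx
  · have : (fun y : R3 ↦ radialCutoff L ‖y‖) =ᶠ[nhds 0] fun _ ↦ 1 := by
      filter_upwards [Metric.ball_mem_nhds (0 : R3) hL] with y hy
      exact radialCutoff_eq_one (norm_nonneg y) (mem_ball_zero_iff.1 hy).le
    simp [this.gradient_eq, gradient_fun_const]
  · exact (hasGradientAt_comp_norm hx (hasDerivAt_radialCutoff L ‖x‖)).gradient

/-- Testing the scattering equation against `φ` times a radial cutoff. -/
theorem integral_radialCutoff_mul_norm_gradient_sq {v φ : R3 → ℝ} {R a L : ℝ} (hR : 0 < R)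
    (hRL : R < L) (hv : LocallyIntegrable fun x ↦ v x * φ x)
    (hv_supp : ∀ x : R3, R < ‖x‖ → v x = 0) (hφ_C1 : ContDiff ℝ 1 φ)
    (hφ_eq : ∀ x : R3, R ≤ ‖x‖ → φ x = 1 - a / ‖x‖)
    (hφ_scatt : ∀ g : R3 → ℝ, ContDiff ℝ (⊤ : ℕ∞) g → HasCompactSupport g →
      (∫ x : R3, ⟪gradient φ x, gradient g x⟫) + (1/2) * ∫ x : R3, v x * φ x * g x = 0) :
    (∫ x : R3, radialCutoff L ‖x‖ * ‖gradient φ x‖ ^ 2) + (1/2) * (∫ x : R3, v x * φ x ^ 2) =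
      4 * π * (a - a ^ 2 * (∫ t in Set.Ioi (0 : ℝ), cutoffSlope t) * L⁻¹) := by
  have hL : 0 < L := hR.trans hRL
  have hφd : Differentiable ℝ φ := hφ_C1.differentiable (by simp)
  have hcont : Continuous (gradient φ) :=
    (LinearIsometryEquiv.continuous _).comp (hφ_C1.continuous_fderiv (by simp))
  let χ : R3 → ℝ := fun x ↦ radialCutoff L ‖x‖
  have hχ : ContDiff ℝ 1 χ := mod_cast contDiff_radialCutoff_norm L (n := 1)
  have hχd : Differentiable ℝ χ := hχ.differentiable (by simp)
  have hχ0 (x : R3) (hx : 2 * L ≤ ‖x‖) : χ x = 0 := radialCutoff_eq_zero hL hx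
  have hχcont : Continuous (gradient χ) :=
    (LinearIsometryEquiv.continuous _).comp (hχ.continuous_fderiv (by simp))
  have hχc : HasCompactSupport χ := HasCompactSupport.intro (isCompact_closedBall 0 (2 * L))
    fun x hx ↦ hχ0 x (by simp at hx; exact hx.le)
  have hweak := weak_equation_of_contDiff_one (hcont.locallyIntegrable (μ := volume)) hv hφ_scatt
    (hφ_C1.mul hχ) (R := 2 * L) (fun x hx ↦ by simp [hχ0 x hx])
  have hinner (x : R3) : ⟪gradient φ x, gradient (fun y ↦ φ y * χ y) x⟫ =
      χ x * ‖gradient φ x‖ ^ 2 + φ x * ⟪gradient φ x, gradient χ x⟫ := by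
    have : gradient (fun y ↦ φ y * χ y) x = φ x • gradient χ x + χ x • gradient φ x := by
      simp [gradient, fderiv_fun_mul (hφd x) (hχd x)]
    rw [this, inner_add_right, inner_smul_right, inner_smul_right, real_inner_self_eq_norm_sq,
      add_comm]
  have hflux (x : R3) : φ x * ⟪gradient φ x, gradient χ x⟫ =
      (1 - a / ‖x‖) * ((a / ‖x‖ ^ 2) * (-(‖x‖ / L ^ 2) * cutoffSlope (‖x‖ / L))) := by
    rw [gradient_radialCutoff_norm hL]
    rcases le_or_gt ‖x‖ R with hx | hx
    · rw [cutoffSlope_eq_zero_of_lt_one]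
      · simp
      · rw [abs_of_nonneg (by positivity), div_lt_one hL]
        exact hx.trans_lt hRL
    · have hx0 : ‖x‖ ≠ 0 := (hR.trans hx).ne'
      rw [hφ_eq x hx.le, gradient_of_eq_one_sub_div_norm hR hφ_eq hx, inner_smul_left,
        inner_smul_right, real_inner_self_eq_norm_sq]
      simp
      field_simp
  have hpot (x : R3) : v x * φ x * (φ x * χ x) = v x * φ x ^ 2 := by
    rcases le_or_gt ‖x‖ R with hx | hx
    · simp only [χ, radialCutoff_eq_one (norm_nonneg x) (hx.trans hRL.le)]
      ring
    · simp [hv_supp x hx]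
  have hint₁ : Integrable fun x ↦ χ x * ‖gradient φ x‖ ^ 2 :=
    (hχ.continuous.mul (hcont.norm.pow 2)).integrable_of_hasCompactSupport hχc.mul_right
  have hint₂ : Integrable fun x ↦ φ x * ⟪gradient φ x, gradient χ x⟫ := by
    refine (hφ_C1.continuous.mul (hcont.inner hχcont)).integrable_of_hasCompactSupport ?_
    refine HasCompactSupport.mul_left (HasCompactSupport.of_support_subset_isCompact
      (hχc.fderiv ℝ) fun x hx ↦ subset_closure fun h ↦ hx ?_)
    simp [gradient, h]
  simp only [hpot] at hweak
  rw [integral_congr_ae (.of_forall hinner), integral_add hint₁ hint₂] at hweak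
  simp only [hflux] at hweak
  rw [integral_comp_norm fun r ↦
    (1 - a / r) * ((a / r ^ 2) * (-(r / L ^ 2) * cutoffSlope (r / L))),
    integral_radialCutoff_flux a hL] at hweak
  linear_combination hweak

theorem scattering_length_energy_identity
    (v φ : R3 → ℝ) (R0 a : ℝ) (hR0 : 0 < R0)
    (hv_meas : Measurable v)
    (hv_nonneg : ∀ x, 0 ≤ v x)
    (hv_bdd : ∃ C, ∀ x, v x ≤ C)
    (hv_radial : ∀ x y : R3, ‖x‖ = ‖y‖ → v x = v y)
    (hv_supp : ∀ x : R3, R0 < ‖x‖ → v x = 0)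
    (hφ_C1 : ContDiff ℝ 1 φ)
    (hφ_nonneg : ∀ x, 0 ≤ φ x)
    (hφ_le_one : ∀ x, φ x ≤ 1)
    (hφ_eq : ∀ x : R3, R0 ≤ ‖x‖ → φ x = 1 - a / ‖x‖)
    -- the zero-energy scattering equation `-Δφ + (1/2) v φ = 0` in the
    -- distributional (weak) sense, tested against smooth compactly
    -- supported functions:
    (hφ_scatt : ∀ g : R3 → ℝ, ContDiff ℝ (⊤ : ℕ∞) g → HasCompactSupport g →
      (∫ x : R3, ⟪gradient φ x, gradient g x⟫) + (1/2) * ∫ x : R3, v x * φ x * g x = 0) :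
    (∫ x : R3, ‖gradient φ x‖ ^ 2) + (1/2) * ∫ x : R3, v x * φ x ^ 2 = 4 * π * a := by
  obtain ⟨C, hC⟩ := hv_bdd
  have hv : LocallyIntegrable fun x ↦ v x * φ x := by
    refine (locallyIntegrable_const C).mono
      (hv_meas.aestronglyMeasurable.mul hφ_C1.continuous.aestronglyMeasurable)
      (.of_forall fun x ↦ ?_)
    rw [Real.norm_of_nonneg (mul_nonneg (hv_nonneg x) (hφ_nonneg x)),
      Real.norm_of_nonneg ((hv_nonneg x).trans (hC x))]
    exact (mul_le_of_le_one_right (hv_nonneg x) (hφ_le_one x)).trans (hC x)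
  have hint := integrable_norm_gradient_sq_of_eq_one_sub_div_norm hR0 hφ_C1 hφ_eq
  have hlim : Filter.Tendsto
      (fun n : ℕ ↦ ∫ x : R3, radialCutoff n ‖x‖ * ‖gradient φ x‖ ^ 2) Filter.atTop
      (nhds (∫ x : R3, ‖gradient φ x‖ ^ 2)) := by
    refine tendsto_integral_of_dominated_convergence _ (fun n ↦ ?_) hint
      (fun n ↦ .of_forall fun x ↦ ?_) (.of_forall fun x ↦ ?_)
    · exact (contDiff_radialCutoff_norm n (n := 0)).continuous.aestronglyMeasurable.mul
        hint.aestronglyMeasurable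
    · rw [radialCutoff, Real.norm_of_nonneg (mul_nonneg (smoothTransition.nonneg _) (by positivity))]
      exact mul_le_of_le_one_left (by positivity) (smoothTransition.le_one _)
    · refine tendsto_const_nhds.congr' ?_
      filter_upwards [Filter.eventually_ge_atTop ⌈‖x‖⌉₊] with n hn
      rw [radialCutoff_eq_one (norm_nonneg x) (Nat.ceil_le.1 hn), one_mul]
  have hlhs := hlim.add_const ((1/2) * ∫ x : R3, v x * φ x ^ 2)
  have hrhs : Filter.Tendsto
      (fun n : ℕ ↦ 4 * π * (a - a ^ 2 * (∫ t in Set.Ioi (0 : ℝ), cutoffSlope t) * (n : ℝ)⁻¹))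
      Filter.atTop (nhds (4 * π * a)) := by
    simpa using ((tendsto_inv_atTop_nhds_zero_nat (𝕜 := ℝ)).const_mul
      (a ^ 2 * ∫ t in Set.Ioi (0 : ℝ), cutoffSlope t)).const_sub a |>.const_mul (4 * π)
  refine tendsto_nhds_unique hlhs (hrhs.congr' ?_)
  filter_upwards [Filter.eventually_gt_atTop ⌈R0⌉₊] with n hn
  exact (integral_radialCutoff_mul_norm_gradient_sq hR0 (Nat.lt_of_ceil_lt hn) hv hv_supp hφ_C1
    hφ_eq hφ_scatt).symm
end
end

section
/- Dyson's Lemma: Let v be a potential with scattering length a_v supported in {|x| < R₀} as in the context. Let R > R₀, let θ_R be the characteristic function of the ball {|x| < R}, and let U: ℝ³ → [0,∞) be a measurable radial function supported in the annulus {R₀ ≤ |x| ≤ R} with ∫_{ℝ³} U(x) dx = 4π. Then for every function ψ ∈ H¹({|x| < R}), ∫_{|x| < R} ( |∇ψ(x)|² + (1/2) v(x) |ψ(x)|² ) dx ≥ a_v ∫_{ℝ³} U(x) |ψ(x)|² dx. -/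
/-!
STATEMENT 6: Dyson's Lemma.
Let `v` be as in the scattering context (nonnegative, bounded, measurable,
radial, supported in `{|x| < R₀}`, with scattering length `a`). Let `R > R₀`
and let `U : ℝ³ → [0,∞)` be a measurable radial function supported in the
annulus `{R₀ ≤ |x| ≤ R}` with `∫ U = 4π`. Then for every `ψ ∈ H¹({|x| < R})`
(formalized on the dense subclass of restrictions of `C¹(ℝ³)` functions),
`∫_{|x|<R} (|∇ψ|² + (1/2) v |ψ|²) ≥ a ∫ U |ψ|²`.
-/

open MeasureTheory Real
open scoped RealInnerProductSpace

noncomputable section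

/-- `|∇f|²(x) = ∑_j |∂_j f(x)|²` for a complex-valued function on ℝ³. -/
def gradSq (f : R3 → ℂ) (x : R3) : ℝ :=
  ∑ j : Fin 3, ‖fderiv ℝ f x (EuclideanSpace.single j 1)‖ ^ 2

section Polar

variable {E : Type*} [NormedAddCommGroup E] [NormedSpace ℝ E] [FiniteDimensional ℝ E]
  [MeasurableSpace E] [BorelSpace E] (μ : Measure E) [μ.IsAddHaarMeasure]

theorem integrable_polar {f : E → ℝ} (hf : Integrable f μ) :
    Integrable (fun p : Metric.sphere (0 : E) 1 × Set.Ioi (0 : ℝ) ↦ f (p.2.1 • p.1.1))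
      (μ.toSphere.prod (.volumeIoiPow (Module.finrank ℝ E - 1))) := by
  rw [← μ.measurePreserving_homeomorphUnitSphereProd.integrable_comp_emb
    (Homeomorph.measurableEmbedding _)]
  have h : Integrable (fun x : ({(0)}ᶜ : Set E) ↦ f x.1) (μ.comap (↑)) :=
    (integrableOn_iff_comap_subtypeVal (measurableSet_singleton (0 : E)).compl).1 hf.integrableOn
  refine h.congr (.of_forall fun x ↦ ?_)
  have hx : ‖x.1‖ ≠ 0 := norm_ne_zero_iff.2 x.2
  simp [smul_smul, hx]

theorem integral_polar [Nontrivial E] {f : E → ℝ} (hf : Integrable f μ) :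
    ∫ x, f x ∂μ = ∫ t : Set.Ioi (0 : ℝ), ∫ ω : Metric.sphere (0 : E) 1, f (t.1 • ω.1) ∂μ.toSphere
      ∂(.volumeIoiPow (Module.finrank ℝ E - 1)) := by
  calc ∫ x, f x ∂μ = ∫ x : ({(0)}ᶜ : Set E), f x.1 ∂(μ.comap (↑)) := by
        rw [integral_subtype_comap (measurableSet_singleton (0 : E)).compl,
          restrict_compl_singleton]
    _ = ∫ p, f (p.2.1 • p.1.1) ∂(μ.toSphere.prod (.volumeIoiPow (Module.finrank ℝ E - 1))) := by
        rw [← μ.measurePreserving_homeomorphUnitSphereProd.integral_comp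
          (Homeomorph.measurableEmbedding _)]
        refine integral_congr_ae (.of_forall fun x ↦ ?_)
        have hx : ‖x.1‖ ≠ 0 := norm_ne_zero_iff.2 x.2
        simp [smul_smul, hx]
    _ = _ := integral_prod_symm _ (integrable_polar μ hf)

end Polar

section Mollification

open Filter Topology ContinuousLinearMap Convolution

variable {E : Type*} [NormedAddCommGroup E] [InnerProductSpace ℝ E] [FiniteDimensional ℝ E]
  [MeasurableSpace E] [BorelSpace E] (μ : Measure E) [μ.IsAddHaarMeasure]

theorem norm_normed_convolution_le (ρ : ContDiffBump (0 : E)) {g : E → ℝ} {C : ℝ}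
    (hg : Continuous g) (hC : ∀ x, |g x| ≤ C) (x : E) :
    |(ρ.normed μ ⋆[lsmul ℝ ℝ, μ] g) x| ≤ C := by
  have h := dist_convolution_le (f := ρ.normed μ) (μ := μ) (g := g) (z₀ := (0 : ℝ)) (x₀ := x)
    ((abs_nonneg _).trans (hC 0)) ρ.support_normed_eq.subset ρ.nonneg_normed ρ.integral_normed
    hg.aestronglyMeasurable (fun y _ ↦ by simpa using hC y)
  simpa using h

theorem normed_convolution_eq_zero (ρ : ContDiffBump (0 : E)) {g : E → ℝ} {K : ℝ}
    (hρ : ρ.rOut ≤ 1) (hK : ∀ x, K ≤ ‖x‖ → g x = 0) {x : E} (hx : K + 1 ≤ ‖x‖) :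
    (ρ.normed μ ⋆[lsmul ℝ ℝ, μ] g) x = 0 := by
  rw [convolution_def]
  refine integral_eq_zero_of_ae (.of_forall fun y ↦ ?_)
  by_cases hy : y ∈ Function.support (ρ.normed μ)
  · rw [ρ.support_normed_eq, mem_ball_zero_iff] at hy
    have : g (x - y) = 0 := hK _ (by linarith [norm_sub_norm_le x y])
    simp [this]
  · simp [Function.notMem_support.1 hy]

theorem fderiv_normed_convolution_apply (ρ : ContDiffBump (0 : E)) {g : E → ℝ}
    (hg : ContDiff ℝ 1 g) (hgc : HasCompactSupport g) (x w : E) :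
    fderiv ℝ (ρ.normed μ ⋆[lsmul ℝ ℝ, μ] g) x w =
      (ρ.normed μ ⋆[lsmul ℝ ℝ, μ] fun y ↦ fderiv ℝ g y w) x := by
  have hl : LocallyIntegrable (ρ.normed μ) μ := ρ.continuous_normed.locallyIntegrable
  rw [(hgc.hasFDerivAt_convolution_right (lsmul ℝ ℝ) hl hg x).fderiv,
    convolution_precompR_apply _ hl (hgc.fderiv ℝ) (hg.continuous_fderiv one_ne_zero)]

/-- An integral identity tested against smooth compactly supported functions extends to
compactly supported functions of class `C¹`. -/
theorem integral_eq_zero_of_smooth_test {X : E → E} {q : E → ℝ}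
    (hX : Continuous X) (hq : LocallyIntegrable q μ)
    (h : ∀ g : E → ℝ, ContDiff ℝ (⊤ : ℕ∞) g → HasCompactSupport g →
      (∫ x, fderiv ℝ g x (X x) ∂μ) + ∫ x, q x * g x ∂μ = 0)
    {g : E → ℝ} (hg : ContDiff ℝ 1 g) (hgc : HasCompactSupport g) :
    (∫ x, fderiv ℝ g x (X x) ∂μ) + ∫ x, q x * g x ∂μ = 0 := by
  let ρ : ℕ → ContDiffBump (0 : E) := fun n ↦
    ⟨1 / (n + 1) / 2, 1 / (n + 1), by positivity, half_lt_self (by positivity)⟩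
  have hρ1 (n) : (ρ n).rOut ≤ 1 := by
    have : (0 : ℝ) ≤ n := n.cast_nonneg
    exact (div_le_one (by positivity)).2 (by linarith)
  have hρ0 : Tendsto (fun n ↦ (ρ n).rOut) atTop (𝓝 0) := tendsto_one_div_add_atTop_nhds_zero_nat
  have hg' : Continuous (fderiv ℝ g) := hg.continuous_fderiv one_ne_zero
  obtain ⟨C, hC⟩ := hg.continuous.bounded_above_of_compact_support hgc
  obtain ⟨C', hC'⟩ := hg'.bounded_above_of_compact_support (hgc.fderiv ℝ)
  obtain ⟨K, hK⟩ : ∃ K : ℝ, ∀ x, K ≤ ‖x‖ → x ∉ tsupport g := by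
    obtain ⟨K, hK⟩ := hgc.isCompact.isBounded.subset_ball 0
    exact ⟨K, fun x hx hx' ↦ absurd (mem_ball_zero_iff.1 (hK hx')) hx.not_gt⟩
  have hgK (x) (hx : K ≤ ‖x‖) : g x = 0 := image_eq_zero_of_notMem_tsupport (hK x hx)
  have hg'K (x) (hx : K ≤ ‖x‖) : fderiv ℝ g x = 0 :=
    Function.notMem_support.1 fun hx' ↦ hK x hx (support_fderiv_subset ℝ hx')
  have hg'c (w) : Continuous fun y ↦ fderiv ℝ g y w := hg'.clm_apply continuous_const
  set G : ℕ → E → ℝ := fun n ↦ (ρ n).normed μ ⋆[lsmul ℝ ℝ, μ] g with hG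
  have hGs (n) : ContDiff ℝ (⊤ : ℕ∞) (G n) :=
    (ρ n).hasCompactSupport_normed.contDiff_convolution_left _ (ρ n).contDiff_normed
      hg.continuous.locallyIntegrable
  have hGc (n) : HasCompactSupport (G n) :=
    (ρ n).hasCompactSupport_normed.convolution _ hgc
  have hball : MeasurableSet (Metric.closedBall (0 : E) (K + 1)) :=
    Metric.isClosed_closedBall.measurableSet
  have lim1 : Tendsto (fun n ↦ ∫ x, fderiv ℝ (G n) x (X x) ∂μ) atTop
      (𝓝 (∫ x, fderiv ℝ g x (X x) ∂μ)) := by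
    refine tendsto_integral_of_dominated_convergence
      ((Metric.closedBall (0 : E) (K + 1)).indicator fun x ↦ C' * ‖X x‖) (fun n ↦ ?_) ?_
      (fun n ↦ .of_forall fun x ↦ ?_) (.of_forall fun x ↦ ?_)
    · exact (((hGs n).continuous_fderiv (by simp)).clm_apply hX).aestronglyMeasurable
    · rw [integrable_indicator_iff hball]
      exact (continuous_const.mul hX.norm).continuousOn.integrableOn_compact
        (isCompact_closedBall _ _)
    · rw [hG, fderiv_normed_convolution_apply μ _ hg hgc]
      by_cases hx : x ∈ Metric.closedBall (0 : E) (K + 1)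
      · rw [Set.indicator_of_mem hx]
        exact norm_normed_convolution_le μ _ (hg'c _)
          (fun y ↦ (le_opNorm (fderiv ℝ g y) _).trans (by gcongr; exact hC' y)) x
      · rw [Set.indicator_of_notMem hx, normed_convolution_eq_zero μ _ (hρ1 n)
          (K := K) (fun y hy ↦ by simp [hg'K y hy])]
        · simp
        · simpa using (le_of_not_ge (by simpa using hx))
    · simp_rw [hG, fderiv_normed_convolution_apply μ _ hg hgc]
      exact ContDiffBump.convolution_tendsto_right_of_continuous hρ0 (hg'c _) x
  have lim2 : Tendsto (fun n ↦ ∫ x, q x * G n x ∂μ) atTop (𝓝 (∫ x, q x * g x ∂μ)) := by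
    refine tendsto_integral_of_dominated_convergence
      ((Metric.closedBall (0 : E) (K + 1)).indicator fun x ↦ ‖q x‖ * C) (fun n ↦ ?_) ?_
      (fun n ↦ .of_forall fun x ↦ ?_) (.of_forall fun x ↦ ?_)
    · exact hq.aestronglyMeasurable.mul (hGs n).continuous.aestronglyMeasurable
    · rw [integrable_indicator_iff hball]
      exact ((hq.integrableOn_isCompact (isCompact_closedBall _ _)).norm).mul_const _
    · by_cases hx : x ∈ Metric.closedBall (0 : E) (K + 1)
      · rw [Set.indicator_of_mem hx, norm_mul]
        gcongr
        exact norm_normed_convolution_le μ _ hg.continuous hC x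
      · rw [Set.indicator_of_notMem hx, show G n x = 0 from normed_convolution_eq_zero μ _ (hρ1 n) hgK
          (by simpa using (le_of_not_ge (by simpa using hx)))]
        simp
    · exact (ContDiffBump.convolution_tendsto_right_of_continuous hρ0 hg.continuous x).const_mul _
  refine tendsto_nhds_unique (lim1.add lim2) ?_
  simp_rw [h _ (hGs _) (hGc _)]
  exact tendsto_const_nhds

end Mollification

theorem gradSq_nonneg (f : R3 → ℂ) (x : R3) : 0 ≤ gradSq f x :=
  Finset.sum_nonneg fun _ _ ↦ sq_nonneg _

theorem continuous_gradSq {f : R3 → ℂ} (hf : ContDiff ℝ 1 f) : Continuous (gradSq f) :=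
  continuous_finsetSum _ fun _ _ ↦
    ((hf.continuous_fderiv one_ne_zero).clm_apply continuous_const).norm.pow 2

theorem norm_fderiv_apply_le (f : R3 → ℂ) (x w : R3) :
    ‖fderiv ℝ f x w‖ ≤ ‖w‖ * √(gradSq f x) := by
  have hw : w = ∑ j, w j • EuclideanSpace.single j (1 : ℝ) := by
    ext i
    simp [Finset.sum_apply, Pi.single_apply]
  calc ‖fderiv ℝ f x w‖
      = ‖∑ j, w j • fderiv ℝ f x (EuclideanSpace.single j 1)‖ := by
        conv_lhs => rw [hw]
        simp only [map_sum, map_smul]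
    _ ≤ ∑ j, |w j| * ‖fderiv ℝ f x (EuclideanSpace.single j 1)‖ :=
        (norm_sum_le _ _).trans (by simp)
    _ ≤ √(∑ j, |w j| ^ 2) * √(∑ j, ‖fderiv ℝ f x (EuclideanSpace.single j 1)‖ ^ 2) :=
        Real.sum_mul_le_sqrt_mul_sqrt _ _ _
    _ = ‖w‖ * √(gradSq f x) := by
        rw [EuclideanSpace.norm_eq]
        rfl

theorem fderiv_apply_self_of_coulomb {φ : R3 → ℝ} {a R0 : ℝ} (hφ : Differentiable ℝ φ)
    (hR0 : 0 < R0) (hφ_eq : ∀ x : R3, R0 ≤ ‖x‖ → φ x = 1 - a / ‖x‖) {x : R3} (hx : R0 < ‖x‖) :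
    fderiv ℝ φ x x = a / ‖x‖ := by
  have hx0 : ‖x‖ ≠ 0 := (hR0.trans hx).ne'
  have h1 : HasDerivAt (fun s : ℝ ↦ φ (s • x)) (fderiv ℝ φ x x) 1 := by
    have h := (hasDerivAt_id (1 : ℝ)).smul_const x
    simp only [id, one_smul] at h
    exact HasFDerivAt.comp_hasDerivAt_of_eq 1 (hφ x).hasFDerivAt h (by simp)
  have h2 : HasDerivAt (fun s : ℝ ↦ 1 - a / ‖x‖ * s⁻¹) (a / ‖x‖) 1 := by
    have h := ((hasDerivAt_inv (one_ne_zero (α := ℝ))).const_mul (a / ‖x‖)).const_sub 1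
    simpa using h
  refine h1.unique (h2.congr_of_eventuallyEq ?_)
  have hc : ContinuousAt (fun s : ℝ ↦ ‖s • x‖) 1 := by fun_prop
  filter_upwards [hc.eventually (lt_mem_nhds (by simpa using hx : R0 < ‖(1 : ℝ) • x‖)),
    lt_mem_nhds (zero_lt_one (α := ℝ))] with s hs hs0
  rw [hφ_eq _ hs.le, norm_smul, Real.norm_of_nonneg hs0.le]
  field_simp

theorem completed_square_le {p n t S d Q : ℝ} (hp : 0 < p) (ht : |t| ≤ S * d) (hS : 0 ≤ S)
    (hd : d ≤ n * √Q) (hQ : 0 ≤ Q) : 2 * t / p - S ^ 2 * n ^ 2 / p ^ 2 ≤ Q := by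
  have h1 : t ≤ S * (n * √Q) := (le_abs_self t).trans (ht.trans (by gcongr))
  have h2 : 2 * t / p ≤ 2 * (S * (n * √Q)) / p := by gcongr
  have h3 : 0 ≤ (√Q - S * n / p) ^ 2 := sq_nonneg _
  have h4 : (√Q - S * n / p) ^ 2 = Q - 2 * (S * (n * √Q)) / p + S ^ 2 * n ^ 2 / p ^ 2 := by
    rw [sub_sq, Real.sq_sqrt hQ]
    ring
  linarith

theorem fderiv_cutoff_mul_apply {H : ℝ → ℝ} {p : R3 → ℝ} {ψ : R3 → ℂ} {x : R3}
    (hH : DifferentiableAt ℝ H (‖x‖ ^ 2)) (hp : DifferentiableAt ℝ p x) (hp0 : p x ≠ 0)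
    (hψ : DifferentiableAt ℝ ψ x) (w : R3) :
    fderiv ℝ (fun y ↦ H (‖y‖ ^ 2) * (‖ψ y‖ ^ 2 * (p y)⁻¹)) x w =
      2 * deriv H (‖x‖ ^ 2) * ⟪x, w⟫ * (‖ψ x‖ ^ 2 / p x) +
        H (‖x‖ ^ 2) * (2 * ⟪ψ x, fderiv ℝ ψ x w⟫ / p x
          - ‖ψ x‖ ^ 2 * fderiv ℝ p x w / p x ^ 2) := by
  have h1 : HasFDerivAt (fun y : R3 ↦ H (‖y‖ ^ 2)) _ x :=
    hH.hasDerivAt.comp_hasFDerivAt x (hasFDerivAt_id x).norm_sq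
  have h2 := hψ.hasFDerivAt.norm_sq
  have h3 : HasFDerivAt (fun y : R3 ↦ (p y)⁻¹) _ x :=
    (hasDerivAt_inv hp0).comp_hasFDerivAt x hp.hasFDerivAt
  rw [(h1.fun_mul (h2.fun_mul h3)).fderiv]
  simp
  ring

theorem integrable_cutoff_weight_mul {H : ℝ → ℝ} {R0 R : ℝ} (hR0 : 0 < R0) (hR : R0 < R)
    (hH : ContDiff ℝ 1 H) (hH'_high : ∀ t, R ^ 2 ≤ t → deriv H t = 0)
    {f : R3 → ℝ} (hf : Continuous f) :
    Integrable fun x : R3 ↦ -2 * deriv H (‖x‖ ^ 2) / max ‖x‖ R0 * f x := by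
  refine Continuous.integrable_of_hasCompactSupport ?_
    (.intro (isCompact_closedBall 0 R) fun x hx ↦ ?_)
  · have h1 : Continuous fun x : R3 ↦ deriv H (‖x‖ ^ 2) :=
      (hH.continuous_deriv le_rfl).comp (by fun_prop)
    have h2 : Continuous fun x : R3 ↦ max ‖x‖ R0 := by fun_prop
    exact ((continuous_const.mul h1).div h2 fun x ↦ (lt_max_of_lt_right hR0).ne').mul hf
  · have hx' : R < ‖x‖ := by simpa using hx
    have hR' := hR0.trans hR
    simp [hH'_high (‖x‖ ^ 2) (by gcongr)]

/-- Dyson's lemma for a radial weight that is the derivative of a cutoff function. -/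
theorem dyson_lemma_cutoff
    {v φ : R3 → ℝ} {R0 a : ℝ} (hR0 : 0 < R0) (ha : 0 < a)
    (hv_meas : Measurable v) (hv_nonneg : ∀ x, 0 ≤ v x) (hv_bdd : ∃ C, ∀ x, v x ≤ C)
    (hφ_C1 : ContDiff ℝ 1 φ) (hφ_nonneg : ∀ x, 0 ≤ φ x) (hφ_le_one : ∀ x, φ x ≤ 1)
    (hφ_eq : ∀ x : R3, R0 ≤ ‖x‖ → φ x = 1 - a / ‖x‖)
    (hφ_scatt : ∀ g : R3 → ℝ, ContDiff ℝ (⊤ : ℕ∞) g → HasCompactSupport g →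
      (∫ x : R3, ⟪gradient φ x, gradient g x⟫) + (1/2) * ∫ x : R3, v x * φ x * g x = 0)
    {R : ℝ} (hR : R0 < R) {ψ : R3 → ℂ} (hψ : ContDiff ℝ 1 ψ)
    {H : ℝ → ℝ} (hH : ContDiff ℝ 1 H) (hH_nonneg : ∀ t, 0 ≤ H t) (hH_le_one : ∀ t, H t ≤ 1)
    (hH_deriv : ∀ t, deriv H t ≤ 0) (hH_low : ∀ t ≤ R0 ^ 2, deriv H t = 0)
    (hH_high : ∀ t, R ^ 2 ≤ t → H t = 0) :
    a * ∫ x : R3, -2 * deriv H (‖x‖ ^ 2) / max ‖x‖ R0 * ‖ψ x‖ ^ 2 ≤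
      ∫ x in Metric.ball (0 : R3) R, (gradSq ψ x + (1/2) * v x * ‖ψ x‖ ^ 2) := by
  have hRpos : 0 < R := hR0.trans hR
  set p : R3 → ℝ := fun x ↦ φ x + a / R with hp
  have hp_pos (x) : 0 < p x := add_pos_of_nonneg_of_pos (hφ_nonneg x) (by positivity)
  have hp_C1 : ContDiff ℝ 1 p := hφ_C1.add contDiff_const
  have hφd : Differentiable ℝ φ := hφ_C1.differentiable one_ne_zero
  have hpφ (x) : fderiv ℝ p x = fderiv ℝ φ x := fderiv_add_const _
  set g : R3 → ℝ := fun y ↦ H (‖y‖ ^ 2) * (‖ψ y‖ ^ 2 * (p y)⁻¹) with hg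
  have hg_C1 : ContDiff ℝ 1 g :=
    (hH.comp (contDiff_norm_sq ℝ)).mul
      ((hψ.norm_sq ℝ).mul (hp_C1.inv fun x ↦ (hp_pos x).ne'))
  have hH_zero (x : R3) (hx : x ∉ Metric.closedBall (0 : R3) R) : H (‖x‖ ^ 2) = 0 := by
    have hx' : R < ‖x‖ := by simpa using hx
    exact hH_high _ (by gcongr)
  have hH'_high (t) (ht : R ^ 2 ≤ t) : deriv H t = 0 :=
    IsLocalMin.deriv_eq_zero (.of_forall fun s ↦ by rw [hH_high t ht]; exact hH_nonneg s)
  have hg_supp : HasCompactSupport g :=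
    .intro (isCompact_closedBall 0 R) fun x hx ↦ by simp [hg, hH_zero x hx]
  have hX : Continuous (gradient φ) :=
    (InnerProductSpace.toDual ℝ R3).symm.continuous.comp (hφ_C1.continuous_fderiv one_ne_zero)
  obtain ⟨C, hC⟩ := hv_bdd
  have hq : LocallyIntegrable (fun x ↦ 1 / 2 * (v x * φ x)) := by
    refine (locallyIntegrable_const (1 / 2 * C)).mono (by
      exact (measurable_const.mul (hv_meas.mul hφ_C1.continuous.measurable)).aestronglyMeasurable)
      (.of_forall fun x ↦ ?_)
    have h1 := hv_nonneg x
    have h2 := hφ_nonneg x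
    have h3 : 0 ≤ C := h1.trans (hC x)
    rw [Real.norm_of_nonneg (by positivity), Real.norm_of_nonneg (by positivity)]
    have : v x * φ x ≤ C * 1 := mul_le_mul (hC x) (hφ_le_one x) h2 h3
    linarith
  have hweak : (∫ x, fderiv ℝ g x (gradient φ x)) + ∫ x, 1 / 2 * (v x * φ x) * g x = 0 := by
    refine integral_eq_zero_of_smooth_test volume hX hq (fun f hf hfc ↦ ?_) hg_C1 hg_supp
    have h := hφ_scatt f hf hfc
    rw [← integral_const_mul] at h
    rw [← h]
    congr 1
    · exact integral_congr_ae (.of_forall fun x ↦ by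
        beta_reduce
        rw [real_inner_comm, inner_gradient_left])
    · exact integral_congr_ae (.of_forall fun x ↦ by ring)
  have hI1 : Integrable fun x : R3 ↦ a * (-2 * deriv H (‖x‖ ^ 2) / max ‖x‖ R0 * ‖ψ x‖ ^ 2) :=
    (integrable_cutoff_weight_mul hR0 hR hH hH'_high (hψ.continuous.norm.pow 2)).const_mul a
  have hI2 : Integrable fun x : R3 ↦ fderiv ℝ g x (gradient φ x) := by
    refine Continuous.integrable_of_hasCompactSupport
      ((hg_C1.continuous_fderiv one_ne_zero).clm_apply hX) ?_
    exact (hg_supp.fderiv ℝ).mono fun x hx hx' ↦ hx (by simp [hx'])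
  have hI3 : Integrable fun x : R3 ↦ 1 / 2 * (v x * φ x) * g x := by
    simpa [mul_comm] using hq.integrable_smul_left_of_hasCompactSupport hg_C1.continuous hg_supp
  have hI4 : IntegrableOn (fun x ↦ gradSq ψ x + (1/2) * v x * ‖ψ x‖ ^ 2)
      (Metric.ball (0 : R3) R) := by
    have hv_loc : LocallyIntegrable (fun x ↦ 1 / 2 * v x) := by
      refine (locallyIntegrable_const (1 / 2 * C)).mono (by
        exact (measurable_const.mul hv_meas).aestronglyMeasurable) (.of_forall fun x ↦ ?_)
      have h1 := hv_nonneg x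
      have h3 : 0 ≤ C := h1.trans (hC x)
      rw [Real.norm_of_nonneg (by positivity), Real.norm_of_nonneg (by positivity)]
      linarith [hC x]
    have hK := isCompact_closedBall (0 : R3) R
    refine IntegrableOn.mono_set ?_ Metric.ball_subset_closedBall
    exact ((continuous_gradSq hψ).continuousOn.integrableOn_compact hK).add
      ((hv_loc.integrableOn_isCompact hK).mul_continuousOn
        (hψ.continuous.norm.pow 2).continuousOn hK)
  have hpt (x : R3) : a * (-2 * deriv H (‖x‖ ^ 2) / max ‖x‖ R0 * ‖ψ x‖ ^ 2) +
      (fderiv ℝ g x (gradient φ x) + 1 / 2 * (v x * φ x) * g x) ≤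
      (Metric.ball (0 : R3) R).indicator
        (fun x ↦ gradSq ψ x + (1/2) * v x * ‖ψ x‖ ^ 2) x := by
    have hfd := fderiv_cutoff_mul_apply (hH.differentiable one_ne_zero _)
      (hp_C1.differentiable one_ne_zero x) (hp_pos x).ne' (hψ.differentiable one_ne_zero x)
      (gradient φ x)
    have hin : ⟪x, gradient φ x⟫ = fderiv ℝ φ x x := by
      rw [real_inner_comm, inner_gradient_left]
    have hnn : fderiv ℝ φ x (gradient φ x) = ‖gradient φ x‖ ^ 2 := by
      rw [← inner_gradient_left, real_inner_self_eq_norm_sq]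
    rw [hfd, hpφ, hin, hnn]
    by_cases hx : x ∈ Metric.ball (0 : R3) R
    · rw [Set.indicator_of_mem hx]
      have hxR : ‖x‖ < R := by simpa using hx
      have hboundary : a * (-2 * deriv H (‖x‖ ^ 2) / max ‖x‖ R0 * ‖ψ x‖ ^ 2) +
          2 * deriv H (‖x‖ ^ 2) * fderiv ℝ φ x x * (‖ψ x‖ ^ 2 / p x) ≤ 0 := by
        rcases le_or_gt ‖x‖ R0 with hx0 | hx0
        · simp [hH_low (‖x‖ ^ 2) (by gcongr)]
        · have hxpos := hR0.trans hx0
          rw [fderiv_apply_self_of_coulomb hφd hR0 hφ_eq hx0, max_eq_left hx0.le]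
          have hp1 : p x ≤ 1 := by
            have : a / R ≤ a / ‖x‖ := by gcongr
            simp only [hp, hφ_eq x hx0.le]
            linarith
          have h1 : ‖ψ x‖ ^ 2 ≤ ‖ψ x‖ ^ 2 / p x := le_div_self (sq_nonneg _) (hp_pos x) hp1
          have h2 : 0 ≤ -2 * deriv H (‖x‖ ^ 2) * (a / ‖x‖) :=
            mul_nonneg (by linarith [hH_deriv (‖x‖ ^ 2)]) (by positivity)
          have h3 := mul_le_mul_of_nonneg_left h1 h2
          calc _ = -2 * deriv H (‖x‖ ^ 2) * (a / ‖x‖) * ‖ψ x‖ ^ 2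
                - -2 * deriv H (‖x‖ ^ 2) * (a / ‖x‖) * (‖ψ x‖ ^ 2 / p x) := by ring
            _ ≤ 0 := by linarith
      have hsq := completed_square_le (hp_pos x)
        (abs_real_inner_le_norm (ψ x) (fderiv ℝ ψ x (gradient φ x))) (norm_nonneg _)
        (norm_fderiv_apply_le ψ x (gradient φ x)) (gradSq_nonneg ψ x)
      have hpot : 1 / 2 * (v x * φ x) * g x ≤ H (‖x‖ ^ 2) * (1 / 2 * v x * ‖ψ x‖ ^ 2) := by
        have h1 : φ x * (p x)⁻¹ ≤ 1 := by
          rw [← div_eq_mul_inv, div_le_one (hp_pos x)]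
          simp only [hp]
          linarith [div_pos ha hRpos]
        have h2 : 0 ≤ H (‖x‖ ^ 2) * (1 / 2 * v x * ‖ψ x‖ ^ 2) :=
          mul_nonneg (hH_nonneg _) (mul_nonneg (by linarith [hv_nonneg x]) (sq_nonneg _))
        calc _ = H (‖x‖ ^ 2) * (1 / 2 * v x * ‖ψ x‖ ^ 2) * (φ x * (p x)⁻¹) := by
              simp only [hg]
              ring
          _ ≤ _ := mul_le_of_le_one_right h2 h1
      have h1 := mul_le_mul_of_nonneg_left hsq (hH_nonneg (‖x‖ ^ 2))
      have h2 : H (‖x‖ ^ 2) * (gradSq ψ x + 1 / 2 * v x * ‖ψ x‖ ^ 2) ≤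
          gradSq ψ x + 1 / 2 * v x * ‖ψ x‖ ^ 2 :=
        mul_le_of_le_one_left (add_nonneg (gradSq_nonneg ψ x)
          (mul_nonneg (by linarith [hv_nonneg x]) (sq_nonneg _))) (hH_le_one _)
      linarith
    · rw [Set.indicator_of_notMem hx]
      have hxR : R ≤ ‖x‖ := by simpa using hx
      have hxR2 : R ^ 2 ≤ ‖x‖ ^ 2 := by gcongr
      simp [hg, hH'_high _ hxR2, hH_high _ hxR2]
  have hmono := integral_mono (hI1.add (hI2.add hI3))
    (hI4.integrable_indicator Metric.isOpen_ball.measurableSet) hpt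
  rw [integral_indicator Metric.isOpen_ball.measurableSet] at hmono
  rw [← integral_const_mul]
  refine le_trans (le_of_eq ?_) hmono
  have h := integral_add hI1 (hI2.add hI3)
  simp only [Pi.add_apply] at h ⊢
  rw [h, integral_add hI2 hI3, hweak, add_zero]

theorem integral_Ioi_cutoff_weight {H : ℝ → ℝ} {R0 R : ℝ} (hR0 : 0 < R0) (hR : R0 < R)
    (hH : ContDiff ℝ 1 H) (hH_zero : H 0 = 1) (hH_low : ∀ t ≤ R0 ^ 2, deriv H t = 0)
    (hH_high : ∀ t, R ^ 2 ≤ t → H t = 0) (hH'_high : ∀ t, R ^ 2 ≤ t → deriv H t = 0) :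
    ∫ t in Set.Ioi (0 : ℝ), t ^ 2 * (-2 * deriv H (t ^ 2) / max t R0) = 1 := by
  have hderiv (t : ℝ) : HasDerivAt (fun s ↦ -H (s ^ 2)) (-(deriv H (t ^ 2) * (2 * t))) t := by
    have h := (hH.differentiable one_ne_zero (t ^ 2)).hasDerivAt.comp t (hasDerivAt_pow 2 t)
    simpa [Function.comp_def] using h.fun_neg
  have hcont : Continuous fun t : ℝ ↦ -(deriv H (t ^ 2) * (2 * t)) :=
    (((hH.continuous_deriv le_rfl).comp (by fun_prop)).mul (by fun_prop)).neg
  have hint : Integrable fun t : ℝ ↦ -(deriv H (t ^ 2) * (2 * t)) := by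
    refine hcont.integrable_of_hasCompactSupport
      (.intro (isCompact_closedBall 0 R) fun t ht ↦ ?_)
    have ht' : R < |t| := by simpa using ht
    have : R ^ 2 ≤ t ^ 2 := by
      rw [← sq_abs t]
      have := hR0.trans hR
      gcongr
    simp [hH'_high _ this]
  have hlim : Filter.Tendsto (fun s : ℝ ↦ -H (s ^ 2)) Filter.atTop (nhds 0) := by
    refine tendsto_const_nhds.congr' ?_
    filter_upwards [Filter.eventually_ge_atTop R] with t ht
    have := hR0.trans hR
    simp [hH_high (t ^ 2) (by gcongr)]
  have h := integral_Ioi_of_hasDerivAt_of_tendsto' (a := 0) (fun t _ ↦ hderiv t)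
    hint.integrableOn hlim
  refine (setIntegral_congr_fun measurableSet_Ioi fun t (ht : 0 < t) ↦ ?_).trans
    (h.trans (by simp [hH_zero]))
  rcases le_or_gt t R0 with h0 | h0
  · simp [hH_low (t ^ 2) (by gcongr)]
  · simp only [max_eq_left h0.le]
    field_simp

theorem volume_real_ball_R3 : volume.real (Metric.ball (0 : R3) 1) = 4 / 3 * π := by
  rw [measureReal_def, EuclideanSpace.volume_ball_fin_three]
  rw [ENNReal.toReal_mul, ENNReal.toReal_pow, ENNReal.toReal_ofReal zero_le_one,
    ENNReal.toReal_ofReal (by positivity)]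
  ring

theorem integral_radial_mul {F : ℝ → ℝ} {f : R3 → ℝ}
    (hint : Integrable fun x : R3 ↦ F ‖x‖ * f x) :
    Integrable (fun t : Set.Ioi (0 : ℝ) ↦ F t * ∫ ω : Metric.sphere (0 : R3) 1, f (t.1 • ω.1)
      ∂(volume : Measure R3).toSphere) (.volumeIoiPow (Module.finrank ℝ R3 - 1)) ∧
    ∫ x : R3, F ‖x‖ * f x = ∫ t : Set.Ioi (0 : ℝ), F t *
      ∫ ω : Metric.sphere (0 : R3) 1, f (t.1 • ω.1) ∂(volume : Measure R3).toSphere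
        ∂(.volumeIoiPow (Module.finrank ℝ R3 - 1)) := by
  have hcongr (t : Set.Ioi (0 : ℝ)) :
      ∫ ω : Metric.sphere (0 : R3) 1, F ‖t.1 • ω.1‖ * f (t.1 • ω.1)
        ∂(volume : Measure R3).toSphere =
      F t * ∫ ω : Metric.sphere (0 : R3) 1, f (t.1 • ω.1) ∂(volume : Measure R3).toSphere := by
    rw [← integral_const_mul]
    refine integral_congr_ae (.of_forall fun ω ↦ ?_)
    have ht : (0 : ℝ) < t := t.2
    simp [norm_smul, abs_of_pos ht]
  constructor
  · exact ((integrable_polar volume hint).integral_prod_right).congr (.of_forall hcongr)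
  · rw [integral_polar volume hint]
    exact integral_congr_ae (.of_forall hcongr)

theorem integral_radial {F : ℝ → ℝ} (hint : Integrable fun x : R3 ↦ F ‖x‖) :
    Integrable (fun t : Set.Ioi (0 : ℝ) ↦ F t) (.volumeIoiPow (Module.finrank ℝ R3 - 1)) ∧
    ∫ x : R3, F ‖x‖ =
      4 * π * ∫ t : Set.Ioi (0 : ℝ), F t ∂(.volumeIoiPow (Module.finrank ℝ R3 - 1)) := by
  have hσ : (volume : Measure R3).toSphere.real Set.univ = 4 * π := by
    rw [Measure.toSphere_real_apply_univ, volume_real_ball_R3]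
    simp
    ring
  obtain ⟨h1, h2⟩ := integral_radial_mul (F := F) (f := fun _ ↦ 1) (by simpa using hint)
  simp only [integral_const, hσ, mul_one, smul_eq_mul] at h1 h2
  refine ⟨?_, by rw [h2, integral_mul_const, mul_comm]⟩
  refine (h1.mul_const (4 * π)⁻¹).congr (.of_forall fun t ↦ ?_)
  have := Real.pi_pos
  simp only
  field_simp

theorem integral_cutoff_weight {H : ℝ → ℝ} {R0 R : ℝ} (hR0 : 0 < R0) (hR : R0 < R)
    (hH : ContDiff ℝ 1 H) (hH_zero : H 0 = 1) (hH_low : ∀ t ≤ R0 ^ 2, deriv H t = 0)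
    (hH_high : ∀ t, R ^ 2 ≤ t → H t = 0) (hH'_high : ∀ t, R ^ 2 ≤ t → deriv H t = 0) :
    ∫ x : R3, -2 * deriv H (‖x‖ ^ 2) / max ‖x‖ R0 = 4 * π := by
  have h := integral_fun_norm_addHaar (volume : Measure R3)
    (fun t ↦ -2 * deriv H (t ^ 2) / max t R0)
  have h1 := integral_Ioi_cutoff_weight hR0 hR hH hH_zero hH_low hH_high hH'_high
  rw [h, volume_real_ball_R3]
  simp only [finrank_euclideanSpace, Fintype.card_fin, Nat.add_one_sub_one, smul_eq_mul, h1]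
  simp
  ring

/-- A smooth cutoff function descending from `1` to `0` across `[b, c]`. -/
theorem exists_antitone_cutoff {b c : ℝ} (hbc : b < c) :
    ∃ H : ℝ → ℝ, ContDiff ℝ 1 H ∧ (∀ t, 0 ≤ H t) ∧ (∀ t, H t ≤ 1) ∧ (∀ t, deriv H t ≤ 0) ∧
      (∀ t ≤ b, H t = 1) ∧ ∀ t, c ≤ t → H t = 0 := by
  have hbc' : 0 < c - b := sub_pos.2 hbc
  refine ⟨fun t ↦ 1 - smoothTransition ((t - b) / (c - b)), ?_, fun t ↦ ?_, fun t ↦ ?_,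
    fun t ↦ ?_, fun t ht ↦ ?_, fun t ht ↦ ?_⟩
  · exact contDiff_const.sub (smoothTransition.contDiff.comp
      ((contDiff_id.sub contDiff_const).div_const _))
  · exact sub_nonneg.2 (smoothTransition.le_one _)
  · exact sub_le_self _ (smoothTransition.nonneg _)
  · refine Antitone.deriv_nonpos (fun s t hst ↦ ?_)
    exact sub_le_sub_left (smoothTransition.monotone (by gcongr)) _
  · simp [smoothTransition.zero_of_nonpos (div_nonpos_of_nonpos_of_nonneg (sub_nonpos.2 ht) hbc'.le)]
  · have h : 1 ≤ (t - b) / (c - b) := (one_le_div hbc').2 (by linarith)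
    simp [smoothTransition.one_of_one_le h]

theorem continuous_sphere_integral {f : R3 → ℝ} (hf : Continuous f) :
    Continuous fun t : ℝ ↦ ∫ ω : Metric.sphere (0 : R3) 1, f (t • ω.1)
      ∂(volume : Measure R3).toSphere := by
  have h : Continuous fun t : ℝ ↦ ∫ ω : Metric.sphere (0 : R3) 1 in Set.univ, f (t • ω.1)
      ∂(volume : Measure R3).toSphere :=
    continuous_parametric_integral_of_continuous (f := fun (t : ℝ) (ω : Metric.sphere (0 : R3) 1) ↦ f (t • ω.1))
      (by simp only [Function.uncurry_def]; fun_prop) isCompact_univ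
  simpa using h

/-- If a continuous function has small integral against every cutoff weight, then so are its
integrals over the spheres of the annulus. -/
theorem sphere_integral_le_of_cutoff_weight {f : R3 → ℝ} (hf : Continuous f) {R0 R B : ℝ}
    (hR0 : 0 < R0) (hR : R0 < R)
    (hB : ∀ H : ℝ → ℝ, ContDiff ℝ 1 H → (∀ t, 0 ≤ H t) → (∀ t, H t ≤ 1) → (∀ t, deriv H t ≤ 0) →
      (∀ t ≤ R0 ^ 2, deriv H t = 0) → (∀ t, R ^ 2 ≤ t → H t = 0) →
      ∫ x : R3, -2 * deriv H (‖x‖ ^ 2) / max ‖x‖ R0 * f x ≤ B)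
    {s : ℝ} (hs : s ∈ Set.Icc R0 R) :
    ∫ ω : Metric.sphere (0 : R3) 1, f (s • ω.1) ∂(volume : Measure R3).toSphere ≤ B := by
  set M : ℝ → ℝ := fun t ↦ ∫ ω : Metric.sphere (0 : R3) 1, f (t • ω.1)
    ∂(volume : Measure R3).toSphere with hM
  have hMc : Continuous M := continuous_sphere_integral hf
  suffices h : Set.Ioo R0 R ⊆ {t | M t ≤ B} by
    rw [← closure_Ioo hR.ne] at hs
    exact closure_minimal h (isClosed_le hMc continuous_const) hs
  clear hs s
  intro s hs
  by_contra hsB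
  have hsB' : B < M s := not_le.1 hsB
  obtain ⟨b, c, hsbc, hbc⟩ := mem_nhds_iff_exists_Ioo_subset.1
    ((hMc.continuousAt.eventually (lt_mem_nhds hsB')).and (Ioo_mem_nhds hs.1 hs.2))
  obtain ⟨b', hbb', hb's⟩ := exists_between hsbc.1
  obtain ⟨c', hsc', hc'c⟩ := exists_between hsbc.2
  have hb' := hbc ⟨hbb', hb's.trans hsbc.2⟩
  have hc' := hbc ⟨hsbc.1.trans hsc', hc'c⟩
  have hb'0 : 0 < b' := hR0.trans hb'.2.1
  have hc'0 : 0 < c' := hR0.trans hc'.2.1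
  have hb'c' : b' < c' := hb's.trans hsc'
  obtain ⟨H, hH, hH0, hH1, hH', hHlow, hHhigh⟩ :=
    exists_antitone_cutoff (show b' ^ 2 < c' ^ 2 by gcongr)
  have hH'low (t) (ht : t ≤ b' ^ 2) : deriv H t = 0 :=
    IsLocalMax.deriv_eq_zero (.of_forall fun s ↦ by rw [hHlow t ht]; exact hH1 s)
  have hH'high (t) (ht : c' ^ 2 ≤ t) : deriv H t = 0 :=
    IsLocalMin.deriv_eq_zero (.of_forall fun s ↦ by rw [hHhigh t ht]; exact hH0 s)
  have hlow (t) (ht : t ≤ R0 ^ 2) : deriv H t = 0 :=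
    hH'low t (ht.trans (by have := hb'.2.1; gcongr))
  have hcR : c' ^ 2 ≤ R ^ 2 := by have := hc'.2.2; gcongr
  have hhigh (t) (ht : R ^ 2 ≤ t) : deriv H t = 0 := hH'high t (hcR.trans ht)
  set w : ℝ → ℝ := fun t ↦ -2 * deriv H (t ^ 2) / max t R0 with hw
  have hle := hB H hH hH0 hH1 hH' hlow fun t ht ↦ hHhigh t (hcR.trans ht)
  obtain ⟨hi1, he1⟩ := integral_radial_mul (F := w)
    (integrable_cutoff_weight_mul hR0 hR hH hhigh hf)
  obtain ⟨hi2, he2⟩ := integral_radial (F := w)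
    (by simpa only [mul_one] using
      integrable_cutoff_weight_mul hR0 hR hH hhigh (continuous_const (y := (1 : ℝ))))
  have hone := integral_cutoff_weight hR0 hR hH (hHlow 0 (by positivity)) hlow
    (fun t ht ↦ hHhigh t (hcR.trans ht)) hhigh
  rw [he2, mul_eq_left₀ (by positivity)] at hone
  rw [he1] at hle
  have hw_nonneg (t : ℝ) : 0 ≤ w t :=
    div_nonneg (by linarith [hH' (t ^ 2)]) (hR0.le.trans (le_max_right _ _))
  have hw_supp (t : ℝ) (ht : 0 < t) (hwt : w t ≠ 0) : B < M t := by
    have hd : deriv H (t ^ 2) ≠ 0 := fun h0 ↦ hwt (by simp [hw, h0])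
    have h1 : b' < t := by
      by_contra! h
      exact hd (hH'low _ (by gcongr))
    have h2 : t < c' := by
      by_contra! h
      exact hd (hH'high _ (by gcongr))
    exact (hbc ⟨hbb'.trans h1, h2.trans hc'c⟩).1
  have hnn (t : Set.Ioi (0 : ℝ)) : 0 ≤ w t * M t - w t * B := by
    by_cases hwt : w t = 0
    · simp [hwt]
    · rw [← mul_sub]
      exact mul_nonneg (hw_nonneg t) (sub_nonneg.2 (hw_supp t t.2 hwt).le)
  have hzero : ∫ t : Set.Ioi (0 : ℝ), (w t * M t - w t * B)
      ∂(.volumeIoiPow (Module.finrank ℝ R3 - 1)) = 0 := by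
    refine le_antisymm ?_ (integral_nonneg hnn)
    rw [integral_sub hi1 (hi2.mul_const B), integral_mul_const, hone]
    linarith
  rw [integral_eq_zero_iff_of_nonneg hnn (hi1.sub (hi2.mul_const B))] at hzero
  have hw0 : ∫ t : Set.Ioi (0 : ℝ), w t ∂(.volumeIoiPow (Module.finrank ℝ R3 - 1)) = 0 := by
    refine integral_eq_zero_of_ae (hzero.mono fun t ht ↦ ?_)
    by_contra hwt
    have ht' : w t * (M t - B) = 0 := by rw [mul_sub]; exact ht
    exact (mul_ne_zero hwt (sub_pos.2 (hw_supp t t.2 hwt)).ne') ht'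
  exact zero_ne_one (hw0.symm.trans hone)

/-- The integral of a function against a nonnegative radial weight on an annulus is bounded by any
bound for its sphere integrals. -/
theorem integral_radial_weight_mul_le {U f : R3 → ℝ} {R0 R B : ℝ}
    (hU : Integrable U) (hU_nonneg : ∀ x, 0 ≤ U x)
    (hU_radial : ∀ x y : R3, ‖x‖ = ‖y‖ → U x = U y)
    (hU_supp : ∀ x : R3, ‖x‖ < R0 ∨ R < ‖x‖ → U x = 0) (hf : Continuous f)
    (hB : ∀ s ∈ Set.Icc R0 R,
      ∫ ω : Metric.sphere (0 : R3) 1, f (s • ω.1) ∂(volume : Measure R3).toSphere ≤ B) :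
    4 * π * ∫ x : R3, U x * f x ≤ (∫ x : R3, U x) * B := by
  set u : ℝ → ℝ := fun t ↦ U (t • EuclideanSpace.single 0 1) with hu
  have hUu (x : R3) : U x = u ‖x‖ := hU_radial _ _ (by simp [norm_smul])
  have hUf : Integrable fun x ↦ U x * f x := by
    obtain ⟨C, hC⟩ := (isCompact_closedBall (0 : R3) R).exists_bound_of_continuousOn hf.continuousOn
    refine (hU.mul_const C).mono (hU.aestronglyMeasurable.mul hf.aestronglyMeasurable)
      (.of_forall fun x ↦ ?_)
    by_cases hx : x ∈ Metric.closedBall (0 : R3) R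
    · rw [norm_mul, norm_mul]
      gcongr
      exact (hC x hx).trans (le_abs_self C)
    · simp [hU_supp x (.inr (by simpa using hx))]
  have hU' : U = fun x ↦ u ‖x‖ := funext hUu
  rw [hU'] at hU hUf ⊢
  obtain ⟨hi1, he1⟩ := integral_radial_mul (F := u) hUf
  obtain ⟨hi2, he2⟩ := integral_radial (F := u) hU
  rw [he1, he2, mul_assoc (4 * π) _ B, ← integral_mul_const]
  refine mul_le_mul_of_nonneg_left (integral_mono hi1 (hi2.mul_const B) fun t ↦ ?_) (by positivity)
  have ht : (0 : ℝ) < t := t.2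
  by_cases hts : (t : ℝ) ∈ Set.Icc R0 R
  · exact mul_le_mul_of_nonneg_left (hB t hts) (hU_nonneg _)
  · have h0 : u t = 0 := by
      refine hU_supp _ ?_
      rw [norm_smul, Real.norm_of_nonneg ht.le]
      simpa [or_iff_not_imp_left] using hts
    simp [h0]

theorem dyson_lemma
    (v φ : R3 → ℝ) (R0 a : ℝ) (hR0 : 0 < R0)
    (hv_meas : Measurable v)
    (hv_nonneg : ∀ x, 0 ≤ v x)
    (hv_bdd : ∃ C, ∀ x, v x ≤ C)
    (hv_radial : ∀ x y : R3, ‖x‖ = ‖y‖ → v x = v y)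
    (hv_supp : ∀ x : R3, R0 ≤ ‖x‖ → v x = 0)
    (hφ_C1 : ContDiff ℝ 1 φ)
    (hφ_nonneg : ∀ x, 0 ≤ φ x)
    (hφ_le_one : ∀ x, φ x ≤ 1)
    (hφ_eq : ∀ x : R3, R0 ≤ ‖x‖ → φ x = 1 - a / ‖x‖)
    (hφ_scatt : ∀ g : R3 → ℝ, ContDiff ℝ (⊤ : ℕ∞) g → HasCompactSupport g →
      (∫ x : R3, ⟪gradient φ x, gradient g x⟫) + (1/2) * ∫ x : R3, v x * φ x * g x = 0)
    (R : ℝ) (hR : R0 < R)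
    (U : R3 → ℝ)
    (hU_meas : Measurable U)
    (hU_nonneg : ∀ x, 0 ≤ U x)
    (hU_radial : ∀ x y : R3, ‖x‖ = ‖y‖ → U x = U y)
    (hU_supp : ∀ x : R3, ‖x‖ < R0 ∨ R < ‖x‖ → U x = 0)
    (hU_int : (∫ x : R3, U x) = 4 * π)
    (ψ : R3 → ℂ) (hψ : ContDiff ℝ 1 ψ) :
    a * ∫ x : R3, U x * ‖ψ x‖ ^ 2 ≤
      ∫ x in Metric.ball (0 : R3) R, (gradSq ψ x + (1/2) * v x * ‖ψ x‖ ^ 2) := by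
  have hE_nonneg : 0 ≤ ∫ x in Metric.ball (0 : R3) R, (gradSq ψ x + (1/2) * v x * ‖ψ x‖ ^ 2) :=
    integral_nonneg fun x ↦ add_nonneg (gradSq_nonneg ψ x)
      (mul_nonneg (by linarith [hv_nonneg x]) (sq_nonneg _))
  have ha : 0 ≤ a := by
    have hn : ‖(EuclideanSpace.single 0 R0 : R3)‖ = R0 := by simp [abs_of_pos hR0]
    have h := hφ_le_one (EuclideanSpace.single 0 R0)
    rw [hφ_eq _ hn.ge, hn] at h
    by_contra! ha
    linarith [div_neg_of_neg_of_pos ha hR0]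
  rcases ha.eq_or_lt with rfl | ha
  · simpa using hE_nonneg
  have hU : Integrable U := by
    refine not_imp_comm.1 integral_undef ?_
    rw [hU_int]
    positivity
  have hψc : Continuous fun x ↦ ‖ψ x‖ ^ 2 := hψ.continuous.norm.pow 2
  have h := integral_radial_weight_mul_le hU hU_nonneg hU_radial hU_supp hψc fun s hs ↦
    sphere_integral_le_of_cutoff_weight hψc hR0 hR (fun H hH hH0 hH1 hH' hlow hhigh ↦
      (le_div_iff₀' ha).2 (dyson_lemma_cutoff hR0 ha hv_meas hv_nonneg hv_bdd hφ_C1 hφ_nonneg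
        hφ_le_one hφ_eq hφ_scatt hR hψ hH hH0 hH1 hH' hlow hhigh)) hs
  rw [hU_int] at h
  exact (le_div_iff₀' ha).1 (le_of_mul_le_mul_left h (by positivity))
end
end
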